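/- Non-asymptotic Chernoff bound: let N, M : A → B be quantum channels, p ∈ (0,1), and n ∈ ℕ. For any n-round adaptive channel discrimination protocol with type I error α_n and type II error β_n, the symmetric error exponent obeys −(1/n) log₂(p·α_n + (1−p)·β_n) ≤ min{ D̃_{1/2}^A(N‖M), D_max(N‖M), D_max(M‖N) } − (1/n) log₂(p(1−p)), where D̃_{1/2}^A is the amortized channel divergence for the sandwiched Rényi divergence of order 1/2 and D_max(·‖·) is the max-relative entropy channel divergence. -/

import Mathlib

open scoped BigOperators ComplexOrder

noncomputable section

attribute [local instance] Classical.propDecidable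

/-- A density matrix (quantum state): positive semidefinite with unit trace. -/
def IsDensity {ι : Type} [Fintype ι] (ρ : Matrix ι ι ℂ) : Prop :=
  ρ.PosSemidef ∧ ρ.trace = 1

/-- The map `id_R ⊗ Φ` (for linear `Φ`), defined blockwise. -/
def idTensor {R ι κ : Type} (Φ : Matrix ι ι ℂ → Matrix κ κ ℂ)
    (X : Matrix (R × ι) (R × ι) ℂ) : Matrix (R × κ) (R × κ) ℂ :=
  fun p q => Φ (fun a b => X (p.1, a) (q.1, b)) p.2 q.2

/-- The map `Φ ⊗ id_E` (for linear `Φ`), defined blockwise. -/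
def tensorId {ι κ E : Type} (Φ : Matrix ι ι ℂ → Matrix κ κ ℂ)
    (X : Matrix (ι × E) (ι × E) ℂ) : Matrix (κ × E) (κ × E) ℂ :=
  fun p q => Φ (fun a b => X (a, p.2) (b, q.2)) p.1 q.1

/-- A quantum channel: linear, trace preserving, and completely positive. -/
structure IsChannel {ι κ : Type} [Fintype ι] [Fintype κ]
    (Φ : Matrix ι ι ℂ → Matrix κ κ ℂ) : Prop where
  linear : IsLinearMap ℂ Φ
  tracePres : ∀ X, (Φ X).trace = X.trace
  compPos : ∀ (k : ℕ) (X : Matrix (Fin k × ι) (Fin k × ι) ℂ),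
      X.PosSemidef → (idTensor Φ X).PosSemidef

/-- A family of divergences, one for every finite dimension. -/
abbrev DivFam : Type 1 :=
  ∀ (ι : Type) [Fintype ι] [DecidableEq ι], Matrix ι ι ℂ → Matrix ι ι ℂ → EReal

/-- Data processing: a generalized divergence does not increase under channels. -/
def DivDataProcessing (D : DivFam) : Prop :=
  ∀ (ι κ : Type) [Fintype ι] [DecidableEq ι] [Fintype κ] [DecidableEq κ]
    (Φ : Matrix ι ι ℂ → Matrix κ κ ℂ), IsChannel Φ →
    ∀ ρ σ : Matrix ι ι ℂ, IsDensity ρ → IsDensity σ →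
      D κ (Φ ρ) (Φ σ) ≤ D ι ρ σ

/-- Faithfulness: `D(ρ‖ρ) ≤ 0` for every state `ρ`. -/
def DivFaithful (D : DivFam) : Prop :=
  ∀ (ι : Type) [Fintype ι] [DecidableEq ι] (ρ : Matrix ι ι ℂ),
    IsDensity ρ → D ι ρ ρ ≤ 0

/-- Strong faithfulness: `D(ρ‖σ) = 0` iff `ρ = σ`. -/
def DivStronglyFaithful (D : DivFam) : Prop :=
  ∀ (ι : Type) [Fintype ι] [DecidableEq ι] (ρ σ : Matrix ι ι ℂ),
    IsDensity ρ → IsDensity σ → (D ι ρ σ = 0 ↔ ρ = σ)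

/-- The generalized channel divergence `D(N‖M)`. -/
def channelDiv (D : DivFam) {ι κ : Type} [Fintype ι] [DecidableEq ι] [Fintype κ] [DecidableEq κ]
    (N M : Matrix ι ι ℂ → Matrix κ κ ℂ) : EReal :=
  ⨆ (R : ℕ) (ρ : Matrix (Fin R × ι) (Fin R × ι) ℂ) (_ : IsDensity ρ),
    D (Fin R × κ) (idTensor N ρ) (idTensor M ρ)

/-- The amortized channel divergence `D^𝒜(N‖M)`. -/
def amortizedDiv (D : DivFam) {ι κ : Type} [Fintype ι] [DecidableEq ι] [Fintype κ] [DecidableEq κ]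
    (N M : Matrix ι ι ℂ → Matrix κ κ ℂ) : EReal :=
  ⨆ (R : ℕ) (ρ : Matrix (Fin R × ι) (Fin R × ι) ℂ) (σ : Matrix (Fin R × ι) (Fin R × ι) ℂ)
    (_ : IsDensity ρ) (_ : IsDensity σ),
      D (Fin R × κ) (idTensor N ρ) (idTensor M σ) - D (Fin R × ι) ρ σ

/-- Apply a real function to a Hermitian matrix via the spectral decomposition. -/
def hermFun {ι : Type} [Fintype ι] [DecidableEq ι] (f : ℝ → ℝ) (A : Matrix ι ι ℂ) :
    Matrix ι ι ℂ :=
  if hA : A.IsHermitian then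
    (hA.eigenvectorUnitary : Matrix ι ι ℂ) *
      Matrix.diagonal (fun i => (f (hA.eigenvalues i) : ℂ)) *
      star (hA.eigenvectorUnitary : Matrix ι ι ℂ)
  else 0

/-- Real matrix power via spectral calculus, with the generalized-inverse convention `0 ↦ 0`. -/
def matPow {ι : Type} [Fintype ι] [DecidableEq ι] (A : Matrix ι ι ℂ) (r : ℝ) : Matrix ι ι ℂ :=
  hermFun (fun x => if x = 0 then 0 else Real.rpow x r) A

/-- Matrix base-2 logarithm via spectral calculus, taken on the support. -/
def matLog2 {ι : Type} [Fintype ι] [DecidableEq ι] (A : Matrix ι ι ℂ) : Matrix ι ι ℂ :=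
  hermFun (fun x => if x = 0 then 0 else Real.logb 2 x) A

/-- The projection onto the support of a Hermitian matrix. -/
def suppProj {ι : Type} [Fintype ι] [DecidableEq ι] (A : Matrix ι ι ℂ) : Matrix ι ι ℂ :=
  hermFun (fun x => if x = 0 then 0 else 1) A

/-- `supp ρ ⊆ supp σ`, expressed (for Hermitian matrices) as kernel containment
`ker σ ⊆ ker ρ`. -/
def suppLE {ι : Type} [Fintype ι] (ρ σ : Matrix ι ι ℂ) : Prop :=
  ∀ v : ι → ℂ, σ.mulVec v = 0 → ρ.mulVec v = 0

/-- The quantum relative entropy `D(ρ‖σ) = Tr[ρ(log₂ρ − log₂σ)]`,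
`+∞` if the support condition fails. -/
def relEnt {ι : Type} [Fintype ι] [DecidableEq ι] (ρ σ : Matrix ι ι ℂ) : EReal :=
  if suppLE ρ σ then (((ρ * (matLog2 ρ - matLog2 σ)).trace).re : EReal) else ⊤

/-- `−log₂ x` as an extended real, with `−log₂ 0 = +∞`. -/
def negLog2 (x : ℝ) : EReal :=
  if x ≤ 0 then ⊤ else ((-Real.logb 2 x : ℝ) : EReal)

/-- The max-relative entropy `D_max(ρ‖σ) = inf{λ : ρ ≤ 2^λ σ}` (Loewner order). -/
def Dmax {ι : Type} [Fintype ι] (ρ σ : Matrix ι ι ℂ) : EReal :=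
  ⨅ (l : ℝ) (_ : (((2 : ℝ) ^ l) • σ - ρ).PosSemidef), (l : EReal)

/-- The sandwiched Rényi divergence `D̃_α`. -/
def sandRenyi {ι : Type} [Fintype ι] [DecidableEq ι] (α : ℝ) (ρ σ : Matrix ι ι ℂ) : EReal :=
  if α = 1 then relEnt ρ σ
  else if 1 < α ∧ ¬ suppLE ρ σ then ⊤
  else if α < 1 ∧ (ρ * σ).trace = 0 then ⊤
  else ((((α - 1)⁻¹ *
      Real.logb 2
        (((matPow (matPow σ ((1 - α) / (2 * α)) * ρ * matPow σ ((1 - α) / (2 * α))) α).trace).re)) :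
        ℝ) : EReal)

/-- The Petz–Rényi divergence `D_α`. -/
def petzRenyi {ι : Type} [Fintype ι] [DecidableEq ι] (α : ℝ) (ρ σ : Matrix ι ι ℂ) : EReal :=
  if α = 0 then negLog2 (((suppProj ρ * σ).trace).re)
  else if α = 1 then relEnt ρ σ
  else if 1 < α ∧ ¬ suppLE ρ σ then ⊤
  else if α < 1 ∧ (ρ * σ).trace = 0 then ⊤
  else ((((α - 1)⁻¹ * Real.logb 2 (((matPow ρ α * matPow σ (1 - α)).trace).re)) : ℝ) : EReal)

/-- The trace norm `‖X‖₁ = Tr √(XᴴX)`. -/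
def traceNorm {ι : Type} [Fintype ι] [DecidableEq ι] (X : Matrix ι ι ℂ) : ℝ :=
  ((matPow (X.conjTranspose * X) (1/2 : ℝ)).trace).re

/-- The fidelity `F(ρ,σ) = ‖√ρ√σ‖₁²`. -/
def matFidelity {ι : Type} [Fintype ι] [DecidableEq ι] (ρ σ : Matrix ι ι ℂ) : ℝ :=
  (traceNorm (matPow ρ (1/2 : ℝ) * matPow σ (1/2 : ℝ))) ^ 2

def relEntFam : DivFam := fun _ _ _ ρ σ => relEnt ρ σ
def DmaxFam : DivFam := fun _ _ _ ρ σ => Dmax ρ σ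
def sandFam (α : ℝ) : DivFam := fun _ _ _ ρ σ => sandRenyi α ρ σ
def petzFam (α : ℝ) : DivFam := fun _ _ _ ρ σ => petzRenyi α ρ σ
/-- `D̃_{1/2}(ρ‖σ) = −log₂ F(ρ,σ)` as a divergence family. -/
def fidDivFam : DivFam := fun _ _ _ ρ σ => negLog2 (matFidelity ρ σ)

/-- The classical-quantum state `Σ_x p(x) |x⟩⟨x| ⊗ ρ^x`. -/
def cqState {X ι : Type} [DecidableEq X] (p : X → ℝ) (ρ : X → Matrix ι ι ℂ) :
    Matrix (X × ι) (X × ι) ℂ :=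
  fun a b => if a.1 = b.1 then (p a.1 : ℂ) * ρ a.1 a.2 b.2 else 0

/-- The direct-sum property of a generalized divergence on classical-quantum states. -/
def DivDirectSum (D : DivFam) : Prop :=
  ∀ (X ι : Type) [Fintype X] [DecidableEq X] [Fintype ι] [DecidableEq ι]
    (p : X → ℝ), (∀ x, 0 ≤ p x) → (∑ x, p x = 1) →
    ∀ (ρ σ : X → Matrix ι ι ℂ), (∀ x, IsDensity (ρ x)) → (∀ x, IsDensity (σ x)) →
      D (X × ι) (cqState p ρ) (cqState p σ) = ∑ x, (p x : EReal) * D ι (ρ x) (σ x)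

/-- The Kronecker (tensor) product of square matrices. -/
def mkron {ι E : Type} (A : Matrix ι ι ℂ) (B : Matrix E E ℂ) : Matrix (ι × E) (ι × E) ℂ :=
  fun p q => A p.1 q.1 * B p.2 q.2

/-- Sub-additivity of a divergence with respect to tensor-product states. -/
def DivSubAdditive (D : DivFam) : Prop :=
  ∀ (ι E : Type) [Fintype ι] [DecidableEq ι] [Fintype E] [DecidableEq E]
    (ρ σ : Matrix ι ι ℂ) (ω τ : Matrix E E ℂ),
    IsDensity ρ → IsDensity σ → IsDensity ω → IsDensity τ →
      D (ι × E) (mkron ρ ω) (mkron σ τ) ≤ D ι ρ σ + D E ω τ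

/-- The classical-quantum channel `ρ ↦ Σ_x ⟨x|ρ|x⟩ ν^x`. -/
def cqChannel {X κ : Type} [Fintype X] [Fintype κ] (ν : X → Matrix κ κ ℂ) :
    Matrix X X ℂ → Matrix κ κ ℂ :=
  fun ρ => ∑ x, ρ x x • ν x

/-- The maximally entangled state of Schmidt rank `|ι|` on `ι × ι`. -/
def maxEnt (ι : Type) [Fintype ι] [DecidableEq ι] : Matrix (ι × ι) (ι × ι) ℂ :=
  fun p q => if p.1 = p.2 ∧ q.1 = q.2 then ((Fintype.card ι : ℂ))⁻¹ else 0

/-- An `(m+1)`-round adaptive channel discrimination protocol: registers `R_0, …, R_m`,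
a shared initial state, adaptive channels between channel uses, and a final measurement. -/
structure Protocol (ι κ : Type) [Fintype ι] [DecidableEq ι] [Fintype κ] [DecidableEq κ]
    (m : ℕ) where
  r : ℕ → ℕ
  init : Matrix (Fin (r 0) × ι) (Fin (r 0) × ι) ℂ
  init_density : IsDensity init
  adapt : ∀ i : ℕ, Matrix (Fin (r i) × κ) (Fin (r i) × κ) ℂ →
      Matrix (Fin (r (i + 1)) × ι) (Fin (r (i + 1)) × ι) ℂ
  adapt_channel : ∀ i, i < m → IsChannel (adapt i)
  meas : Matrix (Fin (r m) × κ) (Fin (r m) × κ) ℂ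
  meas_psd : meas.PosSemidef
  meas_le_one : ((1 : Matrix (Fin (r m) × κ) (Fin (r m) × κ) ℂ) - meas).PosSemidef

namespace Protocol

variable {ι κ : Type} [Fintype ι] [DecidableEq ι] [Fintype κ] [DecidableEq κ] {m : ℕ}

/-- The state on `R_i ⊗ A` just before the `(i+1)`-st channel use, when the channel is `Ch`. -/
def evolve (P : Protocol ι κ m) (Ch : Matrix ι ι ℂ → Matrix κ κ ℂ) :
    (i : ℕ) → Matrix (Fin (P.r i) × ι) (Fin (P.r i) × ι) ℂ
  | 0 => P.init
  | (i + 1) => P.adapt i (idTensor Ch (P.evolve Ch i))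

/-- The final state on `R_m ⊗ B` after all `m + 1` channel uses. -/
def final (P : Protocol ι κ m) (Ch : Matrix ι ι ℂ → Matrix κ κ ℂ) :
    Matrix (Fin (P.r m) × κ) (Fin (P.r m) × κ) ℂ :=
  idTensor Ch (P.evolve Ch m)

/-- The probability of accepting (deciding for the null hypothesis). -/
def acceptProb (P : Protocol ι κ m) (Ch : Matrix ι ι ℂ → Matrix κ κ ℂ) : ℝ :=
  ((P.meas * P.final Ch).trace).re

/-- The type I error probability `Tr[(I − Q) ρ'⁽ⁿ⁾]`. -/
def typeI (P : Protocol ι κ m) (N : Matrix ι ι ℂ → Matrix κ κ ℂ) : ℝ :=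
  ((((1 : Matrix (Fin (P.r m) × κ) (Fin (P.r m) × κ) ℂ) - P.meas) * P.final N).trace).re

/-- The type II error probability `Tr[Q τ'⁽ⁿ⁾]`. -/
def typeII (P : Protocol ι κ m) (M : Matrix ι ι ℂ → Matrix κ κ ℂ) : ℝ :=
  ((P.meas * P.final M).trace).re

end Protocol

/-- The binary (classical) state `diag(p, 1−p)`. -/
def binState (p : ℝ) : Matrix (Fin 2) (Fin 2) ℂ :=
  Matrix.diagonal (fun i => if i = 0 then (p : ℂ) else ((1 - p : ℝ) : ℂ))

/-- The binary entropy `h₂(ε)`. -/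
def h2 (ε : ℝ) : ℝ := -(ε * Real.logb 2 ε) - (1 - ε) * Real.logb 2 (1 - ε)

/-- `ζ_n(ε, N, M)` with `n = m + 1`: the optimal type II error exponent among all
`(m+1)`-round adaptive protocols with type I error at most `ε`. -/
def steinExp {ι κ : Type} [Fintype ι] [DecidableEq ι] [Fintype κ] [DecidableEq κ]
    (N M : Matrix ι ι ℂ → Matrix κ κ ℂ) (m : ℕ) (ε : ℝ) : EReal :=
  ⨆ (P : Protocol ι κ m) (_ : P.typeI N ≤ ε),
    (((m + 1 : ℝ))⁻¹ : EReal) * negLog2 (P.typeII M)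

/-- Partial trace over the (left) reference system. -/
def ptraceLeft {R ι : Type} [Fintype R] (ψ : Matrix (R × ι) (R × ι) ℂ) : Matrix ι ι ℂ :=
  fun a b => ∑ r, ψ (r, a) (r, b)

/-- The energy-constrained generalized channel divergence. -/
def eChannelDiv (D : DivFam) {ι κ : Type} [Fintype ι] [DecidableEq ι] [Fintype κ] [DecidableEq κ]
    (H : Matrix ι ι ℂ) (E : ℝ) (N M : Matrix ι ι ℂ → Matrix κ κ ℂ) : EReal :=
  ⨆ (R : ℕ) (ψ : Matrix (Fin R × ι) (Fin R × ι) ℂ) (_ : IsDensity ψ)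
    (_ : ((H * ptraceLeft ψ).trace).re ≤ E),
      D (Fin R × κ) (idTensor N ψ) (idTensor M ψ)

/-- The energy-constrained amortized channel divergence. -/
def eAmortizedDiv (D : DivFam) {ι κ : Type} [Fintype ι] [DecidableEq ι] [Fintype κ] [DecidableEq κ]
    (H : Matrix ι ι ℂ) (E : ℝ) (N M : Matrix ι ι ℂ → Matrix κ κ ℂ) : EReal :=
  ⨆ (R : ℕ) (ρ : Matrix (Fin R × ι) (Fin R × ι) ℂ) (σ : Matrix (Fin R × ι) (Fin R × ι) ℂ)
    (_ : IsDensity ρ) (_ : IsDensity σ)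
    (_ : ((H * ptraceLeft ρ).trace).re ≤ E) (_ : ((H * ptraceLeft σ).trace).re ≤ E),
      D (Fin R × κ) (idTensor N ρ) (idTensor M σ) - D (Fin R × ι) ρ σ

/-- `sup_α(ρ/σ)`: supremum of `Tr[Λρ]/Tr[Λσ]` over Hermitian `Λ` with `α⁻¹ I ≤ Λ ≤ I`. -/
def hilbertSup {ι : Type} [Fintype ι] [DecidableEq ι] (α : ℝ) (ρ σ : Matrix ι ι ℂ) : ℝ :=
  sSup { t : ℝ | ∃ Λ : Matrix ι ι ℂ, Λ.IsHermitian ∧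
    (Λ - (α⁻¹ : ℝ) • (1 : Matrix ι ι ℂ)).PosSemidef ∧
    ((1 : Matrix ι ι ℂ) - Λ).PosSemidef ∧
    t = ((Λ * ρ).trace).re / ((Λ * σ).trace).re }

/-- The Hilbert `α`-divergence `H_α(ρ‖σ)`, with `H₁(ρ‖σ) = ‖ρ−σ‖₁ / (2 ln 2)`. -/
def hilbertDiv {ι : Type} [Fintype ι] [DecidableEq ι] (α : ℝ) (ρ σ : Matrix ι ι ℂ) : ℝ :=
  if α = 1 then (2 * Real.log 2)⁻¹ * traceNorm (ρ - σ)
  else (α / (α - 1)) * Real.logb 2 (hilbertSup α ρ σ)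

section SpectralCalculus

variable {ι : Type} [Fintype ι] [DecidableEq ι]

lemma hermFun_of_isHermitian {A : Matrix ι ι ℂ} (hA : A.IsHermitian) (f : ℝ → ℝ) :
    hermFun f A = (hA.eigenvectorUnitary : Matrix ι ι ℂ) *
      Matrix.diagonal (fun i => (f (hA.eigenvalues i) : ℂ)) *
      star (hA.eigenvectorUnitary : Matrix ι ι ℂ) :=
  dif_pos hA

lemma hermFun_mul {A : Matrix ι ι ℂ} (hA : A.IsHermitian) (f g : ℝ → ℝ) :
    hermFun f A * hermFun g A = hermFun (fun x => f x * g x) A := by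
  simp only [hermFun_of_isHermitian hA]
  have hU : star (hA.eigenvectorUnitary : Matrix ι ι ℂ) * (hA.eigenvectorUnitary : Matrix ι ι ℂ)
      = 1 := Unitary.coe_star_mul_self _
  calc _ = (hA.eigenvectorUnitary : Matrix ι ι ℂ) *
      Matrix.diagonal (fun i => (f (hA.eigenvalues i) : ℂ)) *
      (star (hA.eigenvectorUnitary : Matrix ι ι ℂ) * (hA.eigenvectorUnitary : Matrix ι ι ℂ)) *
      Matrix.diagonal (fun i => (g (hA.eigenvalues i) : ℂ)) *
      star (hA.eigenvectorUnitary : Matrix ι ι ℂ) := by simp only [Matrix.mul_assoc]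
    _ = _ := by
      rw [hU, Matrix.mul_one, Matrix.mul_assoc _ (Matrix.diagonal _) (Matrix.diagonal _),
        Matrix.diagonal_mul_diagonal]
      simp

lemma hermFun_congr {A : Matrix ι ι ℂ} (hA : A.IsHermitian) {f g : ℝ → ℝ}
    (h : ∀ i, f (hA.eigenvalues i) = g (hA.eigenvalues i)) : hermFun f A = hermFun g A := by
  simp only [hermFun_of_isHermitian hA, h]

lemma hermFun_id {A : Matrix ι ι ℂ} (hA : A.IsHermitian) : hermFun (fun x => x) A = A := by
  rw [hermFun_of_isHermitian hA]
  conv_rhs => rw [hA.spectral_theorem]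
  rfl

lemma hermFun_posSemidef {A : Matrix ι ι ℂ} (hA : A.IsHermitian) {f : ℝ → ℝ}
    (h : ∀ i, 0 ≤ f (hA.eigenvalues i)) : (hermFun f A).PosSemidef := by
  rw [hermFun_of_isHermitian hA, Matrix.star_eq_conjTranspose]
  refine Matrix.PosSemidef.mul_mul_conjTranspose_same (Matrix.PosSemidef.diagonal ?_) _
  intro i
  simpa using h i

lemma matPow_half_spec {A : Matrix ι ι ℂ} (hA : A.PosSemidef) :
    (matPow A (1 / 2 : ℝ)).PosSemidef ∧ matPow A (1 / 2 : ℝ) * matPow A (1 / 2 : ℝ) = A ∧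
    ∃ T : Matrix ι ι ℂ, T.conjTranspose = T ∧
      matPow A (1 / 2 : ℝ) * T = T * matPow A (1 / 2 : ℝ) ∧
      matPow A (1 / 2 : ℝ) * (T * matPow A (1 / 2 : ℝ)) = matPow A (1 / 2 : ℝ) := by
  have hnn := hA.eigenvalues_nonneg
  refine ⟨hermFun_posSemidef hA.1 fun i => ?_, ?_, matPow A (-(1 / 2) : ℝ),
    (hermFun_posSemidef hA.1 fun i => ?_).1, ?_, ?_⟩
  · split_ifs
    · exact le_rfl
    · exact Real.rpow_nonneg (hnn i) _
  · unfold matPow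
    rw [hermFun_mul hA.1]
    conv_rhs => rw [← hermFun_id hA.1]
    refine hermFun_congr hA.1 fun i => ?_
    split_ifs with h
    · rw [h]; simp
    · have hp := lt_of_le_of_ne (hnn i) (Ne.symm h)
      simp only [Real.rpow_eq_pow]
      rw [← Real.rpow_add hp]
      norm_num
  · split_ifs
    · exact le_rfl
    · exact Real.rpow_nonneg (hnn i) _
  · unfold matPow
    rw [hermFun_mul hA.1, hermFun_mul hA.1]
    exact hermFun_congr hA.1 fun i => mul_comm _ _
  · unfold matPow
    rw [hermFun_mul hA.1, hermFun_mul hA.1]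
    refine hermFun_congr hA.1 fun i => ?_
    split_ifs with h
    · simp
    · have hp := lt_of_le_of_ne (hnn i) (Ne.symm h)
      simp only [Real.rpow_eq_pow]
      rw [← Real.rpow_add hp, ← Real.rpow_add hp]
      norm_num

lemma exists_hermitian_sqrt {A : Matrix ι ι ℂ} (hA : A.PosSemidef) :
    ∃ S : Matrix ι ι ℂ, S.conjTranspose = S ∧ S * S = A :=
  ⟨_, (matPow_half_spec hA).1.1, (matPow_half_spec hA).2.1⟩

lemma re_trace_conjTranspose_mul_self_nonneg {n κ : Type} [Fintype n] [Fintype κ]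
    (E : Matrix n κ ℂ) :
    0 ≤ ((E.conjTranspose * E).trace).re :=
  (Complex.le_def.1 (Matrix.posSemidef_conjTranspose_mul_self E).trace_nonneg).1

lemma re_trace_mul_nonneg {A B : Matrix ι ι ℂ} (hA : A.PosSemidef) (hB : B.PosSemidef) :
    0 ≤ ((A * B).trace).re := by
  obtain ⟨S, hS, rfl⟩ := exists_hermitian_sqrt hA
  have h := (hB.conjTranspose_mul_mul_same S).trace_nonneg
  rw [hS, Matrix.mul_assoc, Matrix.trace_mul_comm, Matrix.mul_assoc, Matrix.trace_mul_comm] at h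
  exact (Complex.le_def.1 h).1

/-- If `BᴴB = R²` and `T` is a generalized inverse of the Hermitian matrix `R`, then the
projection `TR` fixes `B` from the right. -/
lemma mul_pinv_mul_cancel {n κ : Type} [Fintype n] [Fintype κ] {B : Matrix n κ ℂ}
    {R T : Matrix κ κ ℂ}
    (hR : R.conjTranspose = R) (hT : T.conjTranspose = T) (hB : B.conjTranspose * B = R * R)
    (hRTR : R * (T * R) = R) : B * (T * R) = B := by
  have h : (B * (T * R) - B).conjTranspose * (B * (T * R) - B) = 0 := by
    have e : (B * (T * R) - B).conjTranspose * (B * (T * R) - B) =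
        R * T * (B.conjTranspose * B) * (T * R) - R * T * (B.conjTranspose * B)
          - (B.conjTranspose * B) * (T * R) + B.conjTranspose * B := by
      simp only [Matrix.conjTranspose_sub, Matrix.conjTranspose_mul, hR, hT, Matrix.sub_mul,
        Matrix.mul_sub, Matrix.mul_assoc]
      abel
    rw [e, hB]
    have h1 : R * R * (T * R) = R * R := by rw [Matrix.mul_assoc, hRTR]
    rw [Matrix.mul_assoc (R * T), h1]
    abel
  exact sub_eq_zero.1 (Matrix.conjTranspose_mul_self_eq_zero.1 h)

end SpectralCalculus

section Fidelity

variable {ι : Type} [Fintype ι] [DecidableEq ι]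

/-- Upper bound half of Uhlmann's theorem. -/
lemma re_trace_le_traceNorm_sqrt {n : Type} [Fintype n] (B C : Matrix n ι ℂ) :
    ((B.conjTranspose * C).trace).re ≤
      traceNorm (matPow (B.conjTranspose * B) (1 / 2 : ℝ) *
        matPow (C.conjTranspose * C) (1 / 2 : ℝ)) := by
  obtain ⟨hRp, hRR, T, hT, hRT, hRTR⟩ :=
    matPow_half_spec (Matrix.posSemidef_conjTranspose_mul_self B)
  obtain ⟨hSp, hSS, V, hV, hSV, hSVS⟩ :=
    matPow_half_spec (Matrix.posSemidef_conjTranspose_mul_self C)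
  set R := matPow (B.conjTranspose * B) (1 / 2 : ℝ)
  set S := matPow (C.conjTranspose * C) (1 / 2 : ℝ)
  unfold traceNorm
  obtain ⟨hGp, hGG, W, hW, hGW, hGWG⟩ :=
    matPow_half_spec (Matrix.posSemidef_conjTranspose_mul_self (R * S))
  set G := matPow ((R * S).conjTranspose * (R * S)) (1 / 2 : ℝ)
  obtain ⟨K, hK, hKK⟩ := exists_hermitian_sqrt hGp
  have hR : R.conjTranspose = R := hRp.1
  have hS : S.conjTranspose = S := hSp.1
  have hG : G.conjTranspose = G := hGp.1
  clear_value G R S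
  have hB : B * (T * R) = B := mul_pinv_mul_cancel hR hT hRR.symm hRTR
  have hC : C * (V * S) = C := mul_pinv_mul_cancel hS hV hSS.symm hSVS
  have hY : R * S * (W * G) = R * S := mul_pinv_mul_cancel hG hW hGG.symm hGWG
  obtain ⟨U, hU⟩ : ∃ U, U = R * S * W := ⟨_, rfl⟩
  have hYc : (R * S).conjTranspose = S * R := by rw [Matrix.conjTranspose_mul, hR, hS]
  have hUc : U.conjTranspose = W * (S * R) := by
    rw [hU, Matrix.conjTranspose_mul, hYc, hW]
  have hGUc : G * U.conjTranspose = S * R := by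
    have := congrArg Matrix.conjTranspose hY
    rw [hYc, Matrix.conjTranspose_mul, hYc, Matrix.conjTranspose_mul, hW, hG, Matrix.mul_assoc]
      at this
    rw [hUc, this]
  have hTRU : T * R * U = U := by
    rw [← hRT, hU, Matrix.mul_assoc R S W]
    calc R * T * (R * (S * W)) = R * (T * R) * (S * W) := by simp only [Matrix.mul_assoc]
      _ = _ := by rw [hRTR]
  have hUU : U.conjTranspose * U * G = G := by
    calc U.conjTranspose * U * G = W * ((R * S).conjTranspose * (R * S)) * W * G := by
          rw [hUc, hU, hYc]; simp only [Matrix.mul_assoc]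
      _ = W * G * (G * (W * G)) := by rw [← hGG]; simp only [Matrix.mul_assoc]
      _ = G := by rw [hGWG, ← hGW, Matrix.mul_assoc, hGWG]
  have hVSG : V * S * G = G := by
    have e : G = S * (R * R * S * W) := by
      calc G = G * (W * G) := hGWG.symm
        _ = G * G * W := by rw [← hGW]; simp only [Matrix.mul_assoc]
        _ = _ := by rw [hGG, hYc]; simp only [Matrix.mul_assoc]
    calc V * S * G = V * S * (S * (R * R * S * W)) := congrArg _ e
      _ = S * (V * S) * (R * R * S * W) := by
          rw [← Matrix.mul_assoc S V S, hSV]; simp only [Matrix.mul_assoc]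
      _ = G := by rw [hSVS, ← e]
  have key := re_trace_conjTranspose_mul_self_nonneg (B * T * U * K - C * V * K)
  have expand : ((B * T * U * K - C * V * K).conjTranspose * (B * T * U * K - C * V * K)).trace =
      ((B * T * U * K).conjTranspose * (B * T * U * K)).trace
      + ((C * V * K).conjTranspose * (C * V * K)).trace
      - ((B * T * U * K).conjTranspose * (C * V * K)).trace
      - star ((B * T * U * K).conjTranspose * (C * V * K)).trace := by
    rw [← Matrix.trace_conjTranspose, Matrix.conjTranspose_mul _ (C * V * K),
      Matrix.conjTranspose_conjTranspose, Matrix.conjTranspose_sub, Matrix.sub_mul,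
      Matrix.mul_sub, Matrix.mul_sub]
    simp only [Matrix.trace_sub]
    ring
  have t1 : ((B * T * U * K).conjTranspose * (B * T * U * K)).trace = G.trace := by
    calc _ = (K * (U.conjTranspose * T * (B.conjTranspose * B) * T * U * K)).trace := by
          simp only [Matrix.conjTranspose_mul, hK, hT, Matrix.mul_assoc]
      _ = (U.conjTranspose * (T * R * (T * R * U)) * (K * K)).trace := by
          rw [Matrix.trace_mul_comm, ← hRR, ← hRT]
          conv_rhs => rw [hRT]
          congr 1
          simp only [Matrix.mul_assoc]
          rw [← Matrix.mul_assoc R T, hRT]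
          simp only [Matrix.mul_assoc]
      _ = G.trace := by rw [hTRU, hTRU, hKK, hUU]
  have t2 : ((C * V * K).conjTranspose * (C * V * K)).trace = G.trace := by
    calc _ = (K * (V * (C.conjTranspose * C) * V * K)).trace := by
          simp only [Matrix.conjTranspose_mul, hK, hV, Matrix.mul_assoc]
      _ = (V * S * (V * S * (K * K))).trace := by
          rw [Matrix.trace_mul_comm, ← hSS]
          congr 1
          simp only [Matrix.mul_assoc]
          rw [← Matrix.mul_assoc S V, hSV]
          simp only [Matrix.mul_assoc]
      _ = G.trace := by rw [hKK, hVSG, hVSG]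
  have t3 : ((B * T * U * K).conjTranspose * (C * V * K)).trace = (B.conjTranspose * C).trace := by
    calc _ = (K * (U.conjTranspose * T * B.conjTranspose * C * V * K)).trace := by
          simp only [Matrix.conjTranspose_mul, hK, hT, Matrix.mul_assoc]
      _ = ((K * K) * U.conjTranspose * (T * B.conjTranspose * C * V)).trace := by
          rw [Matrix.trace_mul_comm, Matrix.mul_assoc _ K K, Matrix.trace_mul_comm]
          simp only [Matrix.mul_assoc]
      _ = ((R * T * B.conjTranspose) * (C * (V * S))).trace := by
          rw [hKK, hGUc, Matrix.mul_assoc, Matrix.trace_mul_comm]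
          simp only [Matrix.mul_assoc]
      _ = _ := by
          have : R * T * B.conjTranspose = B.conjTranspose := by
            conv_rhs => rw [← hB]
            simp only [Matrix.conjTranspose_mul, hR, hT]
          rw [this, hC]
  rw [expand, t1, t2, t3] at key
  simp only [Complex.sub_re, Complex.add_re, Complex.star_def, Complex.conj_re] at key
  linarith

/-- Attainability half of Uhlmann's theorem. -/
lemma exists_purifications {ρ σ : Matrix ι ι ℂ} (hρ : ρ.PosSemidef) (hσ : σ.PosSemidef) :
    ∃ B C : Matrix (ι ⊕ ι) ι ℂ, B.conjTranspose * B = ρ ∧ C.conjTranspose * C = σ ∧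
      ((B.conjTranspose * C).trace).re =
        traceNorm (matPow ρ (1 / 2 : ℝ) * matPow σ (1 / 2 : ℝ)) := by
  obtain ⟨hRp, hRR, -⟩ := matPow_half_spec hρ
  obtain ⟨hSp, hSS, -⟩ := matPow_half_spec hσ
  set R := matPow ρ (1 / 2 : ℝ)
  set S := matPow σ (1 / 2 : ℝ)
  unfold traceNorm
  obtain ⟨hGp, hGG, W, hW, hGW, hGWG⟩ :=
    matPow_half_spec (Matrix.posSemidef_conjTranspose_mul_self (R * S))
  set G := matPow ((R * S).conjTranspose * (R * S)) (1 / 2 : ℝ)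
  have hR : R.conjTranspose = R := hRp.1
  have hS : S.conjTranspose = S := hSp.1
  have hG : G.conjTranspose = G := hGp.1
  have hYc : (R * S).conjTranspose = S * R := by rw [Matrix.conjTranspose_mul, hR, hS]
  have hP : (W * G).conjTranspose = W * G := by rw [Matrix.conjTranspose_mul, hW, hG, hGW]
  have hPP : W * G * (W * G) = W * G := by rw [Matrix.mul_assoc, hGWG]
  refine ⟨Matrix.fromRows R 0, Matrix.fromRows (R * S * W * S) ((1 - W * G) * S), ?_, ?_, ?_⟩
  · rw [Matrix.conjTranspose_fromRows_eq_fromCols_conjTranspose, Matrix.fromCols_mul_fromRows,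
      hR, hRR]
    simp
  · rw [Matrix.conjTranspose_fromRows_eq_fromCols_conjTranspose, Matrix.fromCols_mul_fromRows]
    have e1 : (R * S * W * S).conjTranspose * (R * S * W * S) = S * (W * G) * S := by
      calc _ = S * (W * ((R * S).conjTranspose * (R * S)) * W) * S := by
            rw [Matrix.conjTranspose_mul, Matrix.conjTranspose_mul _ W, hS, hW]
            simp only [Matrix.mul_assoc]
        _ = S * (W * G * (G * W)) * S := by rw [← hGG]; simp only [Matrix.mul_assoc]
        _ = _ := by rw [hGW, hPP]
    have e2 : ((1 - W * G) * S).conjTranspose * ((1 - W * G) * S) = S * (1 - W * G) * S := by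
      have : (1 - W * G) * (1 - W * G) = 1 - W * G := by
        rw [Matrix.sub_mul, Matrix.mul_sub (W * G), hPP]; simp
      rw [Matrix.conjTranspose_mul, hS, Matrix.conjTranspose_sub, Matrix.conjTranspose_one, hP]
      calc _ = S * ((1 - W * G) * (1 - W * G)) * S := by simp only [Matrix.mul_assoc]
        _ = _ := by rw [this]
    rw [e1, e2, ← Matrix.add_mul, ← Matrix.mul_add, add_sub_cancel, Matrix.mul_one, hSS]
  · rw [Matrix.conjTranspose_fromRows_eq_fromCols_conjTranspose, Matrix.fromCols_mul_fromRows, hR,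
      Matrix.conjTranspose_zero, Matrix.zero_mul, add_zero]
    congr 1
    calc (R * (R * S * W * S)).trace = (R * S * W * (R * S).conjTranspose).trace := by
          rw [Matrix.trace_mul_comm, hYc]; simp only [Matrix.mul_assoc]
      _ = (W * (G * G)).trace := by
          rw [Matrix.mul_assoc, Matrix.trace_mul_comm, Matrix.mul_assoc, hGG]
      _ = G.trace := by rw [← Matrix.mul_assoc, ← hGW, Matrix.mul_assoc, hGWG]

/-- The block of a matrix on `Fin 2 × ι` at position `(i, j)`. -/
def block (M : Matrix (Fin 2 × ι) (Fin 2 × ι) ℂ) (i j : Fin 2) : Matrix ι ι ℂ :=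
  fun a b => M (i, a) (j, b)

lemma re_trace_block_le {M : Matrix (Fin 2 × ι) (Fin 2 × ι) ℂ} (hM : M.PosSemidef) :
    ((block M 0 1).trace).re ≤
      traceNorm (matPow (block M 0 0) (1 / 2 : ℝ) * matPow (block M 1 1) (1 / 2 : ℝ)) := by
  obtain ⟨S, hS, rfl⟩ := exists_hermitian_sqrt hM
  have h (i j : Fin 2) : block (S * S) i j =
      (S.submatrix id (fun a => (i, a))).conjTranspose * S.submatrix id (fun a => (j, a)) := by
    nth_rewrite 1 [← hS]
    rfl
  rw [h, h, h]
  exact re_trace_le_traceNorm_sqrt _ _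

lemma exists_block {ρ σ : Matrix ι ι ℂ} (hρ : ρ.PosSemidef) (hσ : σ.PosSemidef) :
    ∃ M : Matrix (Fin 2 × ι) (Fin 2 × ι) ℂ, M.PosSemidef ∧ block M 0 0 = ρ ∧ block M 1 1 = σ ∧
      ((block M 0 1).trace).re =
        traceNorm (matPow ρ (1 / 2 : ℝ) * matPow σ (1 / 2 : ℝ)) := by
  obtain ⟨B, C, hB, hC, hBC⟩ := exists_purifications hρ hσ
  let D : Matrix (ι ⊕ ι) (Fin 2 × ι) ℂ := fun i q => (![B, C] q.1) i q.2
  exact ⟨D.conjTranspose * D, Matrix.posSemidef_conjTranspose_mul_self D, hB, hC, hBC⟩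

lemma traceNorm_nonneg (X : Matrix ι ι ℂ) : 0 ≤ traceNorm X :=
  (Complex.le_def.1 (matPow_half_spec
    (Matrix.posSemidef_conjTranspose_mul_self X)).1.trace_nonneg).1

lemma matFidelity_mono {κ : Type} [Fintype κ] [DecidableEq κ]
    {Φ : Matrix ι ι ℂ → Matrix κ κ ℂ} (hΦ : IsChannel Φ) {ρ σ : Matrix ι ι ℂ}
    (hρ : ρ.PosSemidef) (hσ : σ.PosSemidef) :
    matFidelity ρ σ ≤ matFidelity (Φ ρ) (Φ σ) := by
  obtain ⟨M, hM, rfl, rfl, hM01⟩ := exists_block hρ hσ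
  have h := re_trace_block_le (hΦ.compPos 2 M hM)
  have hb (i j : Fin 2) : block (idTensor Φ M) i j = Φ (block M i j) := rfl
  rw [hb, hb, hb, hΦ.tracePres, hM01] at h
  exact pow_le_pow_left₀ (traceNorm_nonneg _) h 2

lemma one_le_matFidelity_self {ρ : Matrix ι ι ℂ} (hρ : IsDensity ρ) : 1 ≤ matFidelity ρ ρ := by
  obtain ⟨S, hS, hSS⟩ := exists_hermitian_sqrt hρ.1
  have h := re_trace_le_traceNorm_sqrt S S
  rw [hS, hSS, hρ.2, Complex.one_re] at h
  exact one_le_pow₀ h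

lemma re_trace_mul_le {n : Type} [Fintype n] {Q : Matrix ι ι ℂ} (hQ : Q.PosSemidef)
    (B C : Matrix n ι ℂ) :
    ((Q * (B.conjTranspose * C)).trace).re ^ 2 ≤
      ((Q * (B.conjTranspose * B)).trace).re * ((Q * (C.conjTranspose * C)).trace).re := by
  obtain ⟨D, hD, rfl⟩ := exists_hermitian_sqrt hQ
  have h (X Y : Matrix n ι ℂ) : (D * D * (X.conjTranspose * Y)).trace =
      ((X * D).conjTranspose * (Y * D)).trace := by
    rw [Matrix.conjTranspose_mul, hD, Matrix.mul_assoc, Matrix.trace_mul_comm]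
    simp only [Matrix.mul_assoc]
  rw [h, h, h]
  generalize B * D = X
  generalize C * D = Y
  have hsymm : ((Y.conjTranspose * X).trace).re = ((X.conjTranspose * Y).trace).re := by
    rw [← Matrix.conjTranspose_conjTranspose X, ← Matrix.conjTranspose_mul,
      Matrix.trace_conjTranspose, Matrix.conjTranspose_conjTranspose, Complex.star_def,
      Complex.conj_re]
  have quad (t : ℝ) : 0 ≤ ((X.conjTranspose * X).trace).re * (t * t) +
      (2 * ((X.conjTranspose * Y).trace).re) * t + ((Y.conjTranspose * Y).trace).re := by
    have := re_trace_conjTranspose_mul_self_nonneg ((t : ℂ) • X + Y)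
    simp only [Matrix.conjTranspose_add, Matrix.conjTranspose_smul, Matrix.add_mul, Matrix.mul_add,
      Matrix.trace_add, Matrix.smul_mul, Matrix.mul_smul, Matrix.trace_smul, smul_eq_mul,
      Complex.star_def, Complex.conj_ofReal, Complex.add_re, Complex.re_ofReal_mul, hsymm] at this
    linarith
  have := discrim_le_zero quad
  unfold discrim at this
  linarith

/-- The error of any test in symmetric binary discrimination is bounded below by the fidelity. -/
lemma mul_matFidelity_le_error {ρ σ Q : Matrix ι ι ℂ} (hρ : IsDensity ρ) (hσ : IsDensity σ)
    (hQ : Q.PosSemidef) (hQ1 : (1 - Q).PosSemidef) {p : ℝ} (hp0 : 0 < p) (hp1 : p < 1) :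
    p * (1 - p) * matFidelity ρ σ ≤
      p * (((1 - Q) * ρ).trace).re + (1 - p) * ((Q * σ).trace).re := by
  have nn1 := re_trace_mul_nonneg hQ1 hρ.1
  have nn2 := re_trace_mul_nonneg hQ hσ.1
  have nn3 := re_trace_mul_nonneg hQ hρ.1
  have nn4 := re_trace_mul_nonneg hQ1 hσ.1
  obtain ⟨B, C, hB, hC, hBC⟩ := exists_purifications hρ.1 hσ.1
  have x1 := re_trace_mul_le hQ B C
  have x2 := re_trace_mul_le hQ1 B C
  have sρ : (((1 - Q) * ρ).trace).re = 1 - ((Q * ρ).trace).re := by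
    rw [Matrix.sub_mul, Matrix.one_mul, Matrix.trace_sub, hρ.2]; simp
  have sσ : (((1 - Q) * σ).trace).re = 1 - ((Q * σ).trace).re := by
    rw [Matrix.sub_mul, Matrix.one_mul, Matrix.trace_sub, hσ.2]; simp
  have sX : (((1 - Q) * (B.conjTranspose * C)).trace).re =
      ((B.conjTranspose * C).trace).re - ((Q * (B.conjTranspose * C)).trace).re := by
    rw [Matrix.sub_mul, Matrix.one_mul, Matrix.trace_sub]; simp
  rw [hB, hC] at x1 x2
  unfold matFidelity
  rw [← hBC]
  generalize ((B.conjTranspose * C).trace).re = g at *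
  generalize hx : ((Q * (B.conjTranspose * C)).trace).re = x at *
  rw [sX, sρ, sσ] at x2
  rw [sρ] at nn1 ⊢
  rw [sσ] at nn4
  generalize ((Q * ρ).trace).re = a at *
  generalize ((Q * σ).trace).re = b at *
  have hq : 0 < 1 - p := by linarith
  have cross : 2 * (p * (1 - p)) * (x * (g - x)) ≤
      p ^ 2 * ((1 - a) * a) + (1 - p) ^ 2 * (b * (1 - b)) := by
    have hA : 0 ≤ p ^ 2 * ((1 - a) * a) := by positivity
    have hB : 0 ≤ (1 - p) ^ 2 * (b * (1 - b)) := by positivity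
    refine le_of_sq_le_sq ?_ (add_nonneg hA hB)
    have h12 : (x * (g - x)) ^ 2 ≤ (a * b) * ((1 - a) * (1 - b)) := by
      rw [mul_pow]
      exact mul_le_mul x1 x2 (sq_nonneg _) (mul_nonneg nn3 nn2)
    have := mul_le_mul_of_nonneg_left h12 (show 0 ≤ 4 * (p * (1 - p)) ^ 2 by positivity)
    nlinarith [sq_nonneg (p ^ 2 * ((1 - a) * a) - (1 - p) ^ 2 * (b * (1 - b)))]
  have hpq : 0 < p * (1 - p) := mul_pos hp0 hq
  nlinarith [mul_le_mul_of_nonneg_left x1 hpq.le, mul_le_mul_of_nonneg_left x2 hpq.le,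
    sq_nonneg (p * (1 - a) + (1 - p) * b)]

end Fidelity

section Channels

variable {ι κ : Type} [Fintype ι] [Fintype κ] {Φ : Matrix ι ι ℂ → Matrix κ κ ℂ}

lemma IsChannel.posSemidef (hΦ : IsChannel Φ) {X : Matrix ι ι ℂ} (hX : X.PosSemidef) :
    (Φ X).PosSemidef :=
  (hΦ.compPos 1 _ (hX.submatrix Prod.snd)).submatrix (fun b => ((0 : Fin 1), b))

lemma IsChannel.isDensity (hΦ : IsChannel Φ) {X : Matrix ι ι ℂ} (hX : IsDensity X) :
    IsDensity (Φ X) :=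
  ⟨hΦ.posSemidef hX.1, (hΦ.tracePres X).trans hX.2⟩

lemma IsChannel.smul_sub (hΦ : IsChannel Φ) (c : ℝ) (X Y : Matrix ι ι ℂ) :
    Φ (c • X - Y) = c • Φ X - Φ Y := by
  rw [hΦ.linear.map_sub, ← Complex.coe_smul, hΦ.linear.map_smul, Complex.coe_smul]

lemma IsChannel.idTensor_smul_sub (hΦ : IsChannel Φ) {R : Type} (c : ℝ)
    (X Y : Matrix (R × ι) (R × ι) ℂ) :
    idTensor Φ (c • X - Y) = c • idTensor Φ X - idTensor Φ Y := by
  ext p q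
  exact congrFun (congrFun (hΦ.smul_sub c (fun a b => X (p.1, a) (q.1, b))
    (fun a b => Y (p.1, a) (q.1, b))) p.2) q.2

lemma IsChannel.isDensity_idTensor (hΦ : IsChannel Φ) {k : ℕ}
    {X : Matrix (Fin k × ι) (Fin k × ι) ℂ} (hX : IsDensity X) : IsDensity (idTensor Φ X) := by
  refine ⟨hΦ.compPos k X hX.1, ?_⟩
  rw [← hX.2]
  simp only [Matrix.trace, Matrix.diag, Fintype.sum_prod_type]
  exact Finset.sum_congr rfl fun r _ => hΦ.tracePres (fun a b => X (r, a) (r, b))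

variable [DecidableEq ι] [DecidableEq κ] {m : ℕ} (P : Protocol ι κ m)
  {N M : Matrix ι ι ℂ → Matrix κ κ ℂ}

lemma Protocol.isDensity_evolve (hΦ : IsChannel Φ) :
    ∀ i ≤ m, IsDensity (P.evolve Φ i) := by
  intro i hi
  induction i with
  | zero => exact P.init_density
  | succ i ih =>
    exact (P.adapt_channel i hi).isDensity (hΦ.isDensity_idTensor (ih (Nat.le_of_succ_le hi)))

lemma Protocol.isDensity_final (hΦ : IsChannel Φ) : IsDensity (P.final Φ) :=
  hΦ.isDensity_idTensor (P.isDensity_evolve hΦ m le_rfl)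

/-- An amortized fidelity bound for one channel use gives a bound for the whole protocol. -/
lemma Protocol.pow_le_matFidelity_final (hN : IsChannel N) (hM : IsChannel M) {c : ℝ}
    (h : ∀ (k : ℕ) (ρ σ : Matrix (Fin k × ι) (Fin k × ι) ℂ), IsDensity ρ → IsDensity σ →
      0 < matFidelity ρ σ → c * matFidelity ρ σ ≤ matFidelity (idTensor N ρ) (idTensor M σ))
    (hc : 0 < c) : c ^ (m + 1) ≤ matFidelity (P.final N) (P.final M) := by
  have step (i : ℕ) (hi : i ≤ m) (hF : c ^ i ≤ matFidelity (P.evolve N i) (P.evolve M i)) :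
      c ^ (i + 1) ≤ matFidelity (idTensor N (P.evolve N i)) (idTensor M (P.evolve M i)) := by
    rw [pow_succ']
    exact (mul_le_mul_of_nonneg_left hF hc.le).trans
      (h _ _ _ (P.isDensity_evolve hN i hi) (P.isDensity_evolve hM i hi)
        ((pow_pos hc i).trans_le hF))
  have main (i : ℕ) (hi : i ≤ m) : c ^ i ≤ matFidelity (P.evolve N i) (P.evolve M i) := by
    induction i with
    | zero => simpa using! one_le_matFidelity_self P.init_density
    | succ i ih =>
      have hi' := Nat.le_of_succ_le hi
      exact (step i hi' (ih hi')).trans (matFidelity_mono (P.adapt_channel i hi)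
        (hN.isDensity_idTensor (P.isDensity_evolve hN i hi')).1
        (hM.isDensity_idTensor (P.isDensity_evolve hM i hi')).1)
  exact step m le_rfl (main m le_rfl)

/-- A Loewner bound for one channel use gives a bound for the whole protocol. -/
lemma Protocol.posSemidef_smul_final_sub (hN : IsChannel N) (hM : IsChannel M) {c : ℝ}
    (h : ∀ (k : ℕ) (ρ : Matrix (Fin k × ι) (Fin k × ι) ℂ), IsDensity ρ →
      (c • idTensor M ρ - idTensor N ρ).PosSemidef)
    (hc : 0 < c) : (c ^ (m + 1) • P.final M - P.final N).PosSemidef := by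
  have step (i : ℕ) (hi : i ≤ m) (hF : (c ^ i • P.evolve M i - P.evolve N i).PosSemidef) :
      (c ^ (i + 1) • idTensor M (P.evolve M i) - idTensor N (P.evolve N i)).PosSemidef := by
    have h1 := ((hM.compPos _ _ hF).smul hc.le).add (h _ _ (P.isDensity_evolve hN i hi))
    rwa [hM.idTensor_smul_sub, _root_.smul_sub, smul_smul, ← pow_succ', sub_add_sub_cancel] at h1
  have main (i : ℕ) (hi : i ≤ m) : (c ^ i • P.evolve M i - P.evolve N i).PosSemidef := by
    induction i with
    | zero => simpa [Protocol.evolve] using! Matrix.PosSemidef.zero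
    | succ i ih =>
      have hi' := Nat.le_of_succ_le hi
      have := (P.adapt_channel i hi).posSemidef (step i hi' (ih hi'))
      rwa [(P.adapt_channel i hi).smul_sub] at this
  exact step m le_rfl (main m le_rfl)

end Channels

section Divergences

variable {ι κ : Type} [Fintype ι] [DecidableEq ι] [Fintype κ] [DecidableEq κ]
  {N M : Matrix ι ι ℂ → Matrix κ κ ℂ} {l : ℝ}

lemma mul_matFidelity_le_of_amortizedDiv_lt (h : amortizedDiv fidDivFam N M < (l : EReal)) {k : ℕ}
    {ρ σ : Matrix (Fin k × ι) (Fin k × ι) ℂ} (hρ : IsDensity ρ) (hσ : IsDensity σ)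
    (hF : 0 < matFidelity ρ σ) :
    (2 : ℝ) ^ (-l) * matFidelity ρ σ ≤ matFidelity (idTensor N ρ) (idTensor M σ) := by
  have h1 : negLog2 (matFidelity (idTensor N ρ) (idTensor M σ)) - negLog2 (matFidelity ρ σ)
      < (l : EReal) := by
    refine lt_of_le_of_lt ?_ h
    unfold amortizedDiv
    refine le_iSup_of_le k ?_
    refine le_iSup_of_le ρ ?_
    refine le_iSup_of_le σ ?_
    exact le_iSup_of_le hρ (le_iSup_of_le hσ le_rfl)
  generalize matFidelity ρ σ = F at *
  generalize matFidelity (idTensor N ρ) (idTensor M σ) = F' at *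
  unfold negLog2 at h1
  rw [if_neg hF.not_ge] at h1
  split_ifs at h1 with hF'
  · rw [EReal.top_sub_coe] at h1
    exact absurd h1 not_top_lt
  · rw [not_le] at hF'
    rw [← EReal.coe_sub, EReal.coe_lt_coe_iff] at h1
    rw [← Real.logb_le_logb one_lt_two (by positivity) hF',
      Real.logb_mul (by positivity) hF.ne', Real.logb_rpow two_pos (by norm_num)]
    linarith

lemma posSemidef_of_channelDiv_lt (hM : IsChannel M)
    (h : channelDiv DmaxFam N M < (l : EReal)) {k : ℕ}
    {ρ : Matrix (Fin k × ι) (Fin k × ι) ℂ} (hρ : IsDensity ρ) :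
    ((2 : ℝ) ^ l • idTensor M ρ - idTensor N ρ).PosSemidef := by
  have h1 : Dmax (idTensor N ρ) (idTensor M ρ) < (l : EReal) := by
    refine lt_of_le_of_lt ?_ h
    unfold channelDiv
    refine le_iSup_of_le k ?_
    refine le_iSup_of_le ρ ?_
    exact le_iSup_of_le hρ le_rfl
  unfold Dmax at h1
  simp only [iInf_lt_iff, EReal.coe_lt_coe_iff] at h1
  obtain ⟨l', hl', hlt⟩ := h1
  have hd : (0 : ℝ) ≤ (2 : ℝ) ^ l - (2 : ℝ) ^ l' :=
    sub_nonneg.2 (Real.rpow_le_rpow_of_exponent_le one_le_two hlt.le)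
  have := ((hM.isDensity_idTensor hρ).1.smul hd).add hl'
  rwa [sub_smul, sub_add_sub_cancel] at this

/-- If `ρ ≤ c σ`, the error of any test discriminating `ρ` from `σ` is bounded below. -/
lemma mul_inv_le_error {n : Type} [Fintype n] [DecidableEq n] {ρ σ Q : Matrix n n ℂ}
    (hρ : IsDensity ρ) (hσ : IsDensity σ) (hQ : Q.PosSemidef) (hQ1 : (1 - Q).PosSemidef) {c : ℝ}
    (hc : 0 < c) (h : (c • σ - ρ).PosSemidef) {p : ℝ} (hp0 : 0 < p) (hp1 : p < 1) :
    p * (1 - p) * c⁻¹ ≤ p * (((1 - Q) * ρ).trace).re + (1 - p) * ((Q * σ).trace).re := by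
  have h1 : 1 ≤ c := by
    have := (Complex.le_def.1 h.trace_nonneg).1
    simpa [Matrix.trace_sub, Matrix.trace_smul, hρ.2, hσ.2] using this
  have h2 : ((Q * ρ).trace).re ≤ c * ((Q * σ).trace).re := by
    have := re_trace_mul_nonneg hQ h
    simpa [Matrix.mul_sub, Matrix.trace_sub, Matrix.trace_smul] using this
  have nn1 := re_trace_mul_nonneg hQ1 hρ.1
  have sρ : (((1 - Q) * ρ).trace).re = 1 - ((Q * ρ).trace).re := by
    rw [Matrix.sub_mul, Matrix.one_mul, Matrix.trace_sub, hρ.2]; simp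
  have nn2 := re_trace_mul_nonneg hQ hρ.1
  rw [sρ] at nn1 ⊢
  generalize ((Q * ρ).trace).re = a at *
  generalize ((Q * σ).trace).re = b at *
  rw [← div_eq_mul_inv, div_le_iff₀ hc]
  have hq : 0 < 1 - p := sub_pos.2 hp1
  nlinarith [mul_le_mul_of_nonneg_left h2 hq.le, mul_nonneg (mul_nonneg hp0.le nn1)
    (sub_nonneg.2 h1), mul_nonneg hq.le nn2, mul_nonneg hp0.le nn1, mul_nonneg hp0.le hp0.le,
    mul_nonneg (mul_nonneg hp0.le hp0.le) nn1, mul_nonneg (mul_nonneg hq.le hq.le) nn2]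

lemma inv_mul_negLog2_add_le {q e : ℝ} {m : ℕ} (hq : 0 < q)
    (h : q * ((2 : ℝ) ^ (-l)) ^ (m + 1) ≤ e) :
    (((m + 1 : ℝ))⁻¹ : EReal) * negLog2 e + ((((m + 1 : ℝ))⁻¹ * Real.logb 2 q : ℝ) : EReal) ≤
      (l : EReal) := by
  have hpos : 0 < q * ((2 : ℝ) ^ (-l)) ^ (m + 1) := by positivity
  have he := hpos.trans_le h
  have hlog := Real.logb_le_logb_of_le one_lt_two hpos h
  rw [Real.logb_mul hq.ne' (by positivity), Real.logb_pow,
    Real.logb_rpow two_pos (by norm_num)] at hlog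
  have hm : (0 : ℝ) < m + 1 := by positivity
  unfold negLog2
  rw [if_neg he.not_ge, ← EReal.coe_inv, ← EReal.coe_mul, ← EReal.coe_add, EReal.coe_le_coe_iff,
    ← mul_add, inv_mul_le_iff₀ hm]
  push_cast at hlog
  linarith

end Divergences

/-- Non-asymptotic Chernoff bound: for an `n = m + 1`-round adaptive
protocol, `−(1/n) log₂(p α_n + (1−p) β_n)` is bounded by
`min{D̃_{1/2}^𝒜(N‖M), D_max(N‖M), D_max(M‖N)} − (1/n) log₂(p(1−p))`. -/
theorem chernoff_nonasymptotic_bound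
    {ι κ : Type} [Fintype ι] [DecidableEq ι] [Fintype κ] [DecidableEq κ]
    (N M : Matrix ι ι ℂ → Matrix κ κ ℂ) (hN : IsChannel N) (hM : IsChannel M)
    (p : ℝ) (hp0 : 0 < p) (hp1 : p < 1) (m : ℕ) (P : Protocol ι κ m) :
    (((m + 1 : ℝ))⁻¹ : EReal) * negLog2 (p * P.typeI N + (1 - p) * P.typeII M) ≤
      min (min (amortizedDiv fidDivFam N M) (channelDiv DmaxFam N M)) (channelDiv DmaxFam M N)
        - (((((m + 1 : ℝ))⁻¹ * Real.logb 2 (p * (1 - p))) : ℝ) : EReal) := by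
  have hq : 0 < p * (1 - p) := mul_pos hp0 (sub_pos.2 hp1)
  have inv_pow (l : ℝ) : ((2 : ℝ) ^ (-l)) ^ (m + 1) = (((2 : ℝ) ^ l) ^ (m + 1))⁻¹ := by
    rw [Real.rpow_neg two_pos.le, inv_pow]
  have hρ := P.isDensity_final hN
  have hσ := P.isDensity_final hM
  rw [EReal.le_sub_iff_add_le (Or.inl (EReal.coe_ne_bot _)) (Or.inl (EReal.coe_ne_top _))]
  refine le_min (le_min ?_ ?_) ?_ <;> rw [← EReal.le_of_forall_lt_iff_le] <;> intro l hl <;>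
    refine inv_mul_negLog2_add_le hq ?_
  · refine le_trans (mul_le_mul_of_nonneg_left (P.pow_le_matFidelity_final hN hM
      (fun k ρ σ => mul_matFidelity_le_of_amortizedDiv_lt hl) (by positivity)) hq.le) ?_
    exact mul_matFidelity_le_error hρ hσ P.meas_psd P.meas_le_one hp0 hp1
  · rw [inv_pow]
    exact mul_inv_le_error hρ hσ P.meas_psd P.meas_le_one (by positivity)
      (P.posSemidef_smul_final_sub hN hM (fun k ρ => posSemidef_of_channelDiv_lt hM hl)
        (by positivity)) hp0 hp1
  · rw [inv_pow]
    have h := mul_inv_le_error hσ hρ P.meas_le_one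
      (by simpa only [sub_sub_cancel] using P.meas_psd) (by positivity)
      (P.posSemidef_smul_final_sub hM hN (fun k ρ => posSemidef_of_channelDiv_lt hN hl)
        (by positivity)) (sub_pos.2 hp1) (sub_lt_self 1 hp0)
    rw [sub_sub_cancel, sub_sub_cancel, mul_comm (1 - p) p] at h
    exact h.trans_eq (add_comm _ _)

end
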